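/- Let K be an o-symmetric convex body in ℝ² (K = −K, o in the interior of K), let P be a parallelogram, and suppose |K|·|K*| ≤ (1+ε)·8 for some ε > 0. Then δ_BM(K,P) ≤ 1 + 200ε. -/

import Mathlib

open MeasureTheory Pointwise Real
open scoped RealInnerProductSpace

/-- Area (two-dimensional Lebesgue measure) of a subset of the plane `ℂ ≅ ℝ²`. -/
noncomputable def area (K : Set ℂ) : ℝ := (volume K).toReal

/-- The polar body `K* = {x : ⟨x,y⟩ ≤ 1 for all y ∈ K}`. -/
def polarBody (K : Set ℂ) : Set ℂ := {x | ∀ y ∈ K, ⟪x, y⟫ ≤ 1}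

/-- A convex body: a compact convex set with nonempty interior. -/
def IsConvexBody (K : Set ℂ) : Prop := Convex ℝ K ∧ IsCompact K ∧ (interior K).Nonempty

/-- `K` is a parallelogram: the convex hull of `c ± u ± v` for linearly independent `u, v`. -/
def IsParallelogram (K : Set ℂ) : Prop :=
  ∃ c u v : ℂ, LinearIndependent ℝ ![u, v] ∧
    K = convexHull ℝ {c + u + v, c + u - v, c - u + v, c - u - v}

/-- Banach–Mazur distance of two planar convex bodies:
`inf {λ₂/λ₁ : ∃ invertible affine A and x with λ₁·A(K) ⊆ L ⊆ λ₂·A(K) + x}`. -/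
noncomputable def distBM (K L : Set ℂ) : ℝ :=
  sInf {r : ℝ | ∃ (l1 l2 : ℝ) (A : ℂ ≃ᵃ[ℝ] ℂ) (x : ℂ), 0 < l1 ∧ 0 < l2 ∧ r = l2 / l1 ∧
    l1 • (A '' K) ⊆ L ∧ L ⊆ x +ᵥ l2 • (A '' K)}

/-- The determinant of two vectors of the plane. -/
noncomputable def planeDet (p q : ℂ) : ℝ := p.re * q.im - p.im * q.re

/-- The open angular sector between the directions `p` and `q`. -/
def sector (p q : ℂ) : Set ℂ := {w | 0 < planeDet p w ∧ 0 < planeDet w q}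

/-- The linear map of the plane sending `1` to `p` and `I` to `q`. -/
noncomputable def frameMap (p q : ℂ) : ℂ →ₗ[ℝ] ℂ :=
  Matrix.toLin Complex.basisOneI Complex.basisOneI !![p.re, q.re; p.im, q.im]

theorem frameMap_apply (p q w : ℂ) : frameMap p q w = w.re • p + w.im • q := by
  apply Complex.ext <;>
    simp [frameMap, Matrix.toLin_apply, Complex.coe_basisOneI_repr, Matrix.mulVec, dotProduct,
      Fin.sum_univ_two] <;> ring

theorem det_frameMap (p q : ℂ) : LinearMap.det (frameMap p q) = planeDet p q := by
  rw [frameMap, LinearMap.det_toLin, Matrix.det_fin_two_of, planeDet]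
  ring

theorem volume_standard_triangle :
    volume {w : ℂ | 0 < w.re ∧ 0 < w.im ∧ w.re + w.im < 1} = ENNReal.ofReal (1 / 2) := by
  have hset : {w : ℂ | 0 < w.re ∧ 0 < w.im ∧ w.re + w.im < 1} =
      Complex.measurableEquivRealProd ⁻¹'
        regionBetween (fun _ => (0 : ℝ)) (fun x => 1 - x) (Set.Ioo 0 1) := by
    ext w
    simp only [regionBetween, Set.mem_ofPred_eq, Set.mem_preimage, Set.mem_Ioo,
      Complex.measurableEquivRealProd_apply]
    constructor
    · rintro ⟨h1, h2, h3⟩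
      exact ⟨⟨h1, by linarith⟩, h2, by linarith⟩
    · rintro ⟨⟨h1, _⟩, h2, h3⟩
      exact ⟨h1, h2, by linarith⟩
  have hint : ∫ y in Set.Ioo (0 : ℝ) 1, ((fun x => 1 - x) - (fun _ => 0) : ℝ → ℝ) y = 1 / 2 := by
    rw [← integral_Ioc_eq_integral_Ioo, ← intervalIntegral.integral_of_le zero_le_one]
    simp only [Pi.sub_apply, sub_zero]
    rw [intervalIntegral.integral_sub (by simp) (by simp)]
    norm_num
  rw [hset, Complex.volume_preserving_equiv_real_prod.measure_preimage_equiv,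
    Measure.volume_eq_prod, volume_regionBetween_eq_integral, hint]
  · exact integrableOn_const (by simp)
  · exact ((continuous_const.sub continuous_id).integrableOn_Icc (a := 0) (b := 1)).mono_set
      Set.Ioo_subset_Icc_self
  · exact measurableSet_Ioo
  · intro x hx
    simpa using hx.2.le

theorem measurableSet_sector (p q : ℂ) : MeasurableSet (sector p q) := by
  have h1 : IsOpen {w | 0 < planeDet p w} :=
    isOpen_lt continuous_const (by unfold planeDet; fun_prop)
  have h2 : IsOpen {w | 0 < planeDet w q} :=
    isOpen_lt continuous_const (by unfold planeDet; fun_prop)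
  exact (h1.inter h2).measurableSet

theorem area_mono {s t : Set ℂ} (h : s ⊆ t) (ht : volume t ≠ ⊤) : area s ≤ area t :=
  ENNReal.toReal_mono ht (measure_mono h)

theorem area_add_le {s t K : Set ℂ} (hs : s ⊆ K) (ht : t ⊆ K) (hst : Disjoint s t)
    (hm : MeasurableSet t) (hK : volume K ≠ ⊤) : area s + area t ≤ area K := by
  have h1 : volume s ≠ ⊤ := measure_ne_top_of_subset hs hK
  have h2 : volume t ≠ ⊤ := measure_ne_top_of_subset ht hK
  rw [area, area, ← ENNReal.toReal_add h1 h2, ← measure_union hst hm]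
  exact area_mono (Set.union_subset hs ht) hK

theorem area_nonneg (s : Set ℂ) : 0 ≤ area s := ENNReal.toReal_nonneg

theorem area_neg (s : Set ℂ) : area (-s) = area s := by
  rw [area, area, Measure.measure_neg]

/-- A convex set containing `0`, `p`, `q` contains the triangle they span. -/
theorem planeDet_le_area_sector {K : Set ℂ} (hK : Convex ℝ K) (hfin : volume K ≠ ⊤)
    {p q : ℂ} (h0 : (0 : ℂ) ∈ K) (hp : p ∈ K) (hq : q ∈ K) :
    planeDet p q / 2 ≤ area (K ∩ sector p q) := by
  rcases le_or_gt (planeDet p q) 0 with h | h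
  · linarith [area_nonneg (K ∩ sector p q)]
  have hsub : frameMap p q '' {w : ℂ | 0 < w.re ∧ 0 < w.im ∧ w.re + w.im < 1} ⊆
      K ∩ sector p q := by
    rintro _ ⟨w, ⟨h1, h2, h3⟩, rfl⟩
    rw [frameMap_apply]
    refine ⟨?_, ?_, ?_⟩
    · have := hK.sum_mem (t := Finset.univ) (w := ![w.re, w.im, 1 - w.re - w.im])
        (z := ![p, q, 0]) (by
          intro i _
          fin_cases i <;> simp <;> linarith) (by simp [Fin.sum_univ_three]) (by
          intro i _
          fin_cases i <;> simp [*])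
      simpa [Fin.sum_univ_three] using this
    · have : planeDet p (w.re • p + w.im • q) = w.im * planeDet p q := by
        simp [planeDet]; ring
      rw [this]; positivity
    · have : planeDet (w.re • p + w.im • q) q = w.re * planeDet p q := by
        simp [planeDet]; ring
      rw [this]; positivity
  have harea : area (frameMap p q '' {w : ℂ | 0 < w.re ∧ 0 < w.im ∧ w.re + w.im < 1}) =
      planeDet p q / 2 := by
    rw [area, Measure.addHaar_image_linearMap, volume_standard_triangle, det_frameMap,
      abs_of_pos h, ← ENNReal.ofReal_mul h.le, ENNReal.toReal_ofReal (by positivity)]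
    ring
  rw [← harea]
  exact area_mono hsub (measure_ne_top_of_subset Set.inter_subset_left hfin)

theorem area_sector_add_le {K : Set ℂ} (hm : MeasurableSet K) (hfin : volume K ≠ ⊤)
    {p z q : ℂ} (hpq : 0 < planeDet p q) (hpz : 0 ≤ planeDet p z) (hzq : 0 ≤ planeDet z q) :
    area (K ∩ sector p z) + area (K ∩ sector z q) ≤ area (K ∩ sector p q) := by
  refine area_add_le (fun w hw => ⟨hw.1, hw.2.1, ?_⟩) (fun w hw => ⟨hw.1, ?_, hw.2.2⟩) ?_
    (hm.inter (measurableSet_sector z q))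
    (measure_ne_top_of_subset Set.inter_subset_left hfin)
  · have key : planeDet p z * planeDet w q =
        planeDet p w * planeDet z q + planeDet p q * planeDet w z := by
      simp only [planeDet]; ring
    refine pos_of_mul_pos_right ?_ hpz
    rw [key]
    have := mul_pos hpq hw.2.2
    have := mul_nonneg hw.2.1.le hzq
    linarith
  · have key : planeDet p w * planeDet z q =
        planeDet p z * planeDet w q + planeDet p q * planeDet z w := by
      simp only [planeDet]; ring
    refine pos_of_mul_pos_left ?_ hzq
    rw [key]
    have := mul_pos hpq hw.2.1
    have := mul_nonneg hpz hw.2.2.le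
    linarith
  · rw [Set.disjoint_left]
    intro w h1 h2
    have h3 := h1.2.2
    have h4 := h2.2.1
    simp only [planeDet] at h3 h4
    linarith

/-- Mutually polar symmetric convex sets `K`, `L`, with a basis `u, v` in `K` whose dual basis
`u', v'` lies in `L`. -/
structure PolarFrame (K L : Set ℂ) (u v u' v' : ℂ) : Prop where
  convex_left : Convex ℝ K
  convex_right : Convex ℝ L
  measurable_left : MeasurableSet K
  measurable_right : MeasurableSet L
  finite_left : volume K ≠ ⊤
  finite_right : volume L ≠ ⊤
  symm_left : K = -K
  symm_right : L = -L
  left_eq : K = polarBody L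
  right_eq : L = polarBody K
  u_mem : u ∈ K
  v_mem : v ∈ K
  u'_mem : u' ∈ L
  v'_mem : v' ∈ L
  det_pos : 0 < planeDet u v
  det_mul : planeDet u' v' * planeDet u v = 1
  expand_left : ∀ w : ℂ, w = ⟪u', w⟫ • u + ⟪v', w⟫ • v
  expand_right : ∀ w : ℂ, w = ⟪u, w⟫ • u' + ⟪v, w⟫ • v'

/-- The area of the part of `K` in the sector of `u, v`, in units of the triangle `0, u, v`. -/
noncomputable def sectorRatio (K : Set ℂ) (u v : ℂ) : ℝ :=
  2 * area (K ∩ sector u v) / planeDet u v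

namespace PolarFrame

variable {K L : Set ℂ} {u v u' v' : ℂ}

theorem swap (F : PolarFrame K L u v u' v') : PolarFrame L K u' v' u v where
  convex_left := F.convex_right
  convex_right := F.convex_left
  measurable_left := F.measurable_right
  measurable_right := F.measurable_left
  finite_left := F.finite_right
  finite_right := F.finite_left
  symm_left := F.symm_right
  symm_right := F.symm_left
  left_eq := F.right_eq
  right_eq := F.left_eq
  u_mem := F.u'_mem
  v_mem := F.v'_mem
  u'_mem := F.u_mem
  v'_mem := F.v_mem
  det_pos := by
    have h1 := F.det_pos
    have h2 := F.det_mul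
    exact pos_of_mul_pos_left (by rw [h2]; exact one_pos) h1.le
  det_mul := by rw [mul_comm]; exact F.det_mul
  expand_left := F.expand_right
  expand_right := F.expand_left

theorem neg_mem (F : PolarFrame K L u v u' v') {w : ℂ} (hw : w ∈ K) : -w ∈ K := by
  rw [F.symm_left]; simpa using hw

/-- The frame rotated by a quarter turn. -/
theorem rotate (F : PolarFrame K L u v u' v') : PolarFrame K L v (-u) v' (-u') where
  convex_left := F.convex_left
  convex_right := F.convex_right
  measurable_left := F.measurable_left
  measurable_right := F.measurable_right
  finite_left := F.finite_left
  finite_right := F.finite_right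
  symm_left := F.symm_left
  symm_right := F.symm_right
  left_eq := F.left_eq
  right_eq := F.right_eq
  u_mem := F.v_mem
  v_mem := F.neg_mem F.u_mem
  u'_mem := F.v'_mem
  v'_mem := F.swap.neg_mem F.u'_mem
  det_pos := by
    have := F.det_pos
    simp only [planeDet, Complex.neg_re, Complex.neg_im] at this ⊢
    linarith
  det_mul := by
    have := F.det_mul
    simp only [planeDet, Complex.neg_re, Complex.neg_im] at this ⊢
    linarith
  expand_left := fun w => by
    rw [inner_neg_left, neg_smul_neg, add_comm]; exact F.expand_left w
  expand_right := fun w => by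
    rw [inner_neg_left, neg_smul_neg, add_comm]; exact F.expand_right w

theorem inner_le_one (F : PolarFrame K L u v u' v') {w z : ℂ} (hw : w ∈ L) (hz : z ∈ K) :
    ⟪w, z⟫ ≤ 1 := by
  rw [F.right_eq] at hw
  exact hw z hz

theorem zero_mem (F : PolarFrame K L u v u' v') : (0 : ℂ) ∈ K := by
  rw [F.left_eq]
  intro y _
  simp

theorem smul_add_smul_mem (F : PolarFrame K L u v u' v') {x y : ℝ}
    (h : ∀ w ∈ K, x * ⟪u', w⟫ + y * ⟪v', w⟫ ≤ 1) : x • u' + y • v' ∈ L := by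
  rw [F.right_eq]
  intro w hw
  rw [inner_add_left, real_inner_smul_left, real_inner_smul_left]
  exact h w hw

/-- The area of the pentagon `0, u, z₁, z₂, v` bounds the sector area from below. -/
theorem pentagon_le (F : PolarFrame K L u v u' v') {x₁ y₁ x₂ y₂ : ℝ}
    (h₁ : x₁ • u + y₁ • v ∈ K) (h₂ : x₂ • u + y₂ • v ∈ K) (hy₁ : 0 ≤ y₁) (hx₂ : 0 ≤ x₂)
    (hy₂ : 0 < y₂) (hc : 0 ≤ x₁ * y₂ - y₁ * x₂) :
    y₁ + (x₁ * y₂ - y₁ * x₂) + x₂ ≤ sectorRatio K u v := by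
  have hd := F.det_pos
  set z₁ := x₁ • u + y₁ • v with hz₁
  set z₂ := x₂ • u + y₂ • v with hz₂
  have e1 : planeDet u z₁ = y₁ * planeDet u v := by simp [hz₁, planeDet]; ring
  have e2 : planeDet u z₂ = y₂ * planeDet u v := by simp [hz₂, planeDet]; ring
  have e3 : planeDet z₁ z₂ = (x₁ * y₂ - y₁ * x₂) * planeDet u v := by
    simp [hz₁, hz₂, planeDet]; ring
  have e4 : planeDet z₂ v = x₂ * planeDet u v := by simp [hz₂, planeDet]; ring
  have s1 := area_sector_add_le F.measurable_left F.finite_left (p := u) (z := z₂) (q := v) hd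
    (by rw [e2]; positivity) (by rw [e4]; positivity)
  have s2 := area_sector_add_le F.measurable_left F.finite_left (p := u) (z := z₁) (q := z₂)
    (by rw [e2]; positivity) (by rw [e1]; positivity) (by rw [e3]; positivity)
  have t1 := planeDet_le_area_sector F.convex_left F.finite_left F.zero_mem F.u_mem h₁
  have t2 := planeDet_le_area_sector F.convex_left F.finite_left F.zero_mem h₁ h₂
  have t3 := planeDet_le_area_sector F.convex_left F.finite_left F.zero_mem h₂ F.v_mem
  rw [e1] at t1
  rw [e3] at t2
  rw [e4] at t3
  rw [sectorRatio, le_div_iff₀ hd]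
  linarith

theorem quadrilateral_le (F : PolarFrame K L u v u' v') {x y : ℝ}
    (h : x • u + y • v ∈ K) (hx : 0 ≤ x) (hy : 0 < y) : x + y ≤ sectorRatio K u v := by
  have := F.pentagon_le (x₁ := 1) (y₁ := 0) (by simpa using F.u_mem) h le_rfl hx hy
    (by linarith)
  linarith

theorem one_le_sectorRatio (F : PolarFrame K L u v u' v') : 1 ≤ sectorRatio K u v := by
  have := F.quadrilateral_le (x := 0) (y := 1) (by simpa using F.v_mem) le_rfl one_pos
  linarith

theorem inner_add_inner_le (F : PolarFrame K L u v u' v') {w : ℂ} (hw : w ∈ K) :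
    ⟪u', w⟫ + ⟪v', w⟫ ≤ sectorRatio K u v := by
  have h1 := F.one_le_sectorRatio
  have hx := F.inner_le_one F.u'_mem hw
  have hy := F.inner_le_one F.v'_mem hw
  rcases le_or_gt ⟪v', w⟫ 0 with h | h
  · linarith
  rcases lt_or_ge ⟪u', w⟫ 0 with h' | h'
  · linarith
  exact F.quadrilateral_le (by rw [← F.expand_left w]; exact hw) h' h

theorem diagonal_mem (F : PolarFrame K L u v u' v') {t : ℝ} (ht : sectorRatio K u v ≤ t) :
    t⁻¹ • u' + t⁻¹ • v' ∈ L := by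
  have h1 := F.one_le_sectorRatio
  refine F.smul_add_smul_mem fun w hw => ?_
  have h2 := F.inner_add_inner_le hw
  rw [← mul_add, inv_mul_le_iff₀ (by linarith)]
  linarith

theorem two_le_mul (F : PolarFrame K L u v u' v') :
    2 ≤ sectorRatio K u v * sectorRatio L u' v' := by
  have h1 := F.one_le_sectorRatio
  have h0 : 0 < (sectorRatio K u v)⁻¹ := by positivity
  have h2 := F.swap.quadrilateral_le (F.diagonal_mem le_rfl) h0.le h0
  calc (2 : ℝ) = sectorRatio K u v * ((sectorRatio K u v)⁻¹ + (sectorRatio K u v)⁻¹) := by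
        field_simp; norm_num
    _ ≤ _ := by gcongr

theorem skew_le (F : PolarFrame K L u v u' v') {s : ℝ} (hs : s • u + s • v ∈ K)
    (hs₁ : 1 / 2 ≤ s) (hs₂ : s ≤ 1) {w : ℂ} (hw : w ∈ K) :
    s * ⟪u', w⟫ + (1 - s) * ⟪v', w⟫ ≤ sectorRatio K u v - s ∧
      (1 - s) * ⟪u', w⟫ + s * ⟪v', w⟫ ≤ sectorRatio K u v - s := by
  have hx := F.inner_le_one F.u'_mem hw
  have hy := F.inner_le_one F.v'_mem hw
  have hA := F.quadrilateral_le hs (by linarith) (by linarith)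
  have hw' := hw
  rw [F.expand_left w] at hw'
  generalize ⟪u', w⟫ = x at *
  generalize ⟪v', w⟫ = y at *
  rcases lt_or_ge y 0 with h | h
  · constructor <;> nlinarith
  rcases lt_or_ge x 0 with h' | h'
  · constructor <;> nlinarith
  rcases le_or_gt y x with hxy | hxy
  · have := F.pentagon_le hw' hs h (by linarith) (by linarith) (by nlinarith)
    constructor <;> nlinarith
  · have := F.pentagon_le hs hw' (by linarith) h' (by linarith) (by nlinarith)
    constructor <;> nlinarith

/-- If the product of the sector ratios is close to its minimum `2`, then the second ratio is
close to `1` or at least close to `2`. -/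
theorem two_sub_mul_sub_one_le (F : PolarFrame K L u v u' v')
    (hB : sectorRatio L u' v' < 2) :
    (2 - sectorRatio L u' v') * (sectorRatio L u' v' - 1) ≤
      2 * (sectorRatio K u v * sectorRatio L u' v' - 2) +
        sectorRatio L u' v' * (sectorRatio K u v * sectorRatio L u' v' - 2) ^ 2 := by
  have hB1 := F.swap.one_le_sectorRatio
  have hAB := F.two_le_mul
  have hs := F.swap.diagonal_mem le_rfl
  have hskew := fun w hw => F.skew_le hs (w := w)
    (by rw [one_div]; gcongr) (inv_le_one_of_one_le₀ hB1) hw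
  have hpent := fun x₁ y₁ x₂ y₂ => F.swap.pentagon_le (x₁ := x₁) (y₁ := y₁) (x₂ := x₂) (y₂ := y₂)
  have hmem := fun x y => F.smul_add_smul_mem (x := x) (y := y)
  generalize sectorRatio K u v = A at *
  generalize sectorRatio L u' v' = B at *
  have hD : 0 < A * B - 1 := by linarith
  have hB0 : 0 < B := by linarith
  have hDeq : A - B⁻¹ = (A * B - 1) / B := by field_simp
  have hD' : 0 < A - B⁻¹ := by rw [hDeq]; positivity
  have hq₁ : (1 / (A * B - 1)) • u' + ((B - 1) / (A * B - 1)) • v' ∈ L := by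
    refine hmem _ _ fun w hw => ?_
    have := (hskew w hw).1
    rw [hDeq, le_div_iff₀ hB0] at this
    have e : (B⁻¹ * ⟪u', w⟫ + (1 - B⁻¹) * ⟪v', w⟫) * B = ⟪u', w⟫ + (B - 1) * ⟪v', w⟫ := by
      field_simp
    rw [e] at this
    rw [div_mul_eq_mul_div, div_mul_eq_mul_div, ← add_div, div_le_one hD, one_mul]
    exact this
  have hq₂ : ((B - 1) / (A * B - 1)) • u' + (1 / (A * B - 1)) • v' ∈ L := by
    refine hmem _ _ fun w hw => ?_
    have := (hskew w hw).2
    rw [hDeq, le_div_iff₀ hB0] at this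
    have e : ((1 - B⁻¹) * ⟪u', w⟫ + B⁻¹ * ⟪v', w⟫) * B = (B - 1) * ⟪u', w⟫ + ⟪v', w⟫ := by
      field_simp
    rw [e] at this
    rw [div_mul_eq_mul_div, div_mul_eq_mul_div, ← add_div, div_le_one hD, one_mul]
    exact this
  have hB1' : 0 ≤ B - 1 := by linarith
  have hcross : 1 / (A * B - 1) * (1 / (A * B - 1)) -
      (B - 1) / (A * B - 1) * ((B - 1) / (A * B - 1)) = (B * (2 - B)) / (A * B - 1) ^ 2 := by
    field_simp; ring
  have hpoly := hpent _ _ _ _ hq₁ hq₂ (by positivity) (by positivity) (by positivity)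
    (by rw [hcross]; exact div_nonneg (mul_nonneg hB0.le (by linarith)) (by positivity))
  rw [hcross] at hpoly
  have e : (B - 1) / (A * B - 1) + B * (2 - B) / (A * B - 1) ^ 2 + (B - 1) / (A * B - 1) =
      (2 * (B - 1) * (A * B - 1) + B * (2 - B)) / (A * B - 1) ^ 2 := by
    field_simp; ring
  rw [e, div_le_iff₀ (by positivity)] at hpoly
  nlinarith

theorem sectorRatio_add_le (F : PolarFrame K L u v u' v') :
    planeDet u v * (sectorRatio K u v + sectorRatio K v (-u)) ≤ area K := by
  have hd := F.det_pos
  have hd' : planeDet v (-u) = planeDet u v := by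
    simp only [planeDet, Complex.neg_re, Complex.neg_im]; ring
  have e : planeDet u v * (sectorRatio K u v + sectorRatio K v (-u)) =
      2 * (area (K ∩ sector u v) + area (K ∩ sector v (-u))) := by
    rw [sectorRatio, sectorRatio, hd']; field_simp
  have hm : MeasurableSet (K ∩ {w | 0 < planeDet u w}) := by
    refine F.measurable_left.inter (isOpen_lt continuous_const ?_).measurableSet
    unfold planeDet
    fun_prop
  have h1 : area (K ∩ sector u v) + area (K ∩ sector v (-u)) ≤
      area (K ∩ {w | 0 < planeDet u w}) := by
    refine area_add_le (fun w hw => ⟨hw.1, hw.2.1⟩) (fun w hw => ⟨hw.1, ?_⟩) ?_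
      (F.measurable_left.inter (measurableSet_sector _ _))
      (measure_ne_top_of_subset Set.inter_subset_left F.finite_left)
    · have := hw.2.2
      simp only [planeDet, Complex.neg_re, Complex.neg_im, Set.mem_ofPred_eq] at this ⊢
      linarith
    · rw [Set.disjoint_left]
      intro w h1 h2
      have h3 := h1.2.2
      have h4 := h2.2.1
      simp only [planeDet] at h3 h4
      linarith
  have h2 : area (-(K ∩ {w | 0 < planeDet u w})) + area (K ∩ {w | 0 < planeDet u w}) ≤
      area K := by
    refine area_add_le (fun w hw => ?_) Set.inter_subset_left ?_ hm F.finite_left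
    · simpa using F.neg_mem hw.1
    · rw [Set.disjoint_left]
      intro w h1 h2
      have h3 := h1.2
      have h4 := h2.2
      simp only [planeDet, Complex.neg_re, Complex.neg_im, Set.mem_ofPred_eq] at h3 h4
      linarith
  rw [area_neg] at h2
  linarith

end PolarFrame

theorem inner_eq_re_add_im (x y : ℂ) : ⟪x, y⟫ = x.re * y.re + x.im * y.im := by
  rw [Complex.inner]
  simp [Complex.mul_re, mul_comm]

/-- The bipolar theorem for closed convex sets containing the origin. -/
theorem polarBody_polarBody {K : Set ℂ} (hK : Convex ℝ K) (hc : IsClosed K)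
    (h0 : (0 : ℂ) ∈ K) : polarBody (polarBody K) = K := by
  apply Set.Subset.antisymm
  · intro x hx
    by_contra hxK
    obtain ⟨f, t, hf, ht⟩ := geometric_hahn_banach_closed_point hK hc hxK
    have ht0 : 0 < t := by simpa using hf 0 h0
    set a := (InnerProductSpace.toDual ℝ ℂ).symm f with ha
    have hfa : ∀ z, ⟪a, z⟫ = f z := fun z => InnerProductSpace.toDual_symm_apply
    have hmem : t⁻¹ • a ∈ polarBody K := by
      intro y hy
      rw [real_inner_smul_left, hfa, inv_mul_le_iff₀ ht0, mul_one]
      exact (hf y hy).le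
    have := hx _ hmem
    rw [real_inner_comm, real_inner_smul_left, hfa, inv_mul_le_iff₀ ht0] at this
    linarith
  · intro x hx y hy
    rw [real_inner_comm]
    exact hy x hx

theorem convex_polarBody (K : Set ℂ) : Convex ℝ (polarBody K) := by
  intro x hx y hy a b ha hb hab z hz
  rw [inner_add_left, real_inner_smul_left, real_inner_smul_left]
  have := mul_le_mul_of_nonneg_left (hx z hz) ha
  have := mul_le_mul_of_nonneg_left (hy z hz) hb
  linarith

theorem isClosed_polarBody (K : Set ℂ) : IsClosed (polarBody K) := by
  have : polarBody K = ⋂ y ∈ K, {x : ℂ | ⟪x, y⟫ ≤ 1} := by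
    ext x; simp [polarBody]
  rw [this]
  exact isClosed_biInter fun y _ =>
    isClosed_le (continuous_id.inner continuous_const) continuous_const

theorem volume_polarBody_ne_top {K : Set ℂ} (h0 : (0 : ℂ) ∈ interior K) :
    volume (polarBody K) ≠ ⊤ := by
  obtain ⟨r, hr, hball⟩ := Metric.nhds_basis_closedBall.mem_iff.1 (mem_interior_iff_mem_nhds.1 h0)
  have hfin : volume (Metric.closedBall (0 : ℂ) r⁻¹) ≠ ⊤ :=
    (isCompact_closedBall _ _).measure_lt_top.ne
  refine measure_ne_top_of_subset ?_ hfin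
  intro x hx
  rw [mem_closedBall_zero_iff]
  rcases eq_or_ne x 0 with rfl | hx0
  · simpa using hr.le
  have hn : 0 < ‖x‖ := norm_pos_iff.2 hx0
  have := hx ((r / ‖x‖) • x) (hball (by
    rw [mem_closedBall_zero_iff, norm_smul, Real.norm_eq_abs, abs_of_pos (by positivity)]
    field_simp; rfl))
  rw [real_inner_smul_right, real_inner_self_eq_norm_sq] at this
  rw [← one_div, le_div_iff₀ hr]
  calc ‖x‖ * r = r / ‖x‖ * ‖x‖ ^ 2 := by field_simp
    _ ≤ 1 := this

/-- A symmetric convex body has a frame spanning a parallelogram of maximal area. -/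
theorem exists_polarFrame {K : Set ℂ} (hK : IsConvexBody K) (hsym : K = -K)
    (ho : (0 : ℂ) ∈ interior K) :
    ∃ u v u' v' : ℂ, PolarFrame K (polarBody K) u v u' v' := by
  obtain ⟨hconv, hcomp, -⟩ := hK
  have h0 : (0 : ℂ) ∈ K := interior_subset ho
  obtain ⟨⟨u, v⟩, ⟨hu, hv⟩, hmax⟩ := (hcomp.prod hcomp).exists_isMaxOn ⟨(0, 0), h0, h0⟩
    (f := fun p : ℂ × ℂ => planeDet p.1 p.2) (by unfold planeDet; fun_prop)
  dsimp only at hu hv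
  have hmax' : ∀ p ∈ K, ∀ q ∈ K, planeDet p q ≤ planeDet u v :=
    fun p hp q hq => hmax (Set.mk_mem_prod hp hq)
  have hneg : ∀ w ∈ K, -w ∈ K := fun w hw => by rw [hsym]; simpa using hw
  obtain ⟨r, hr, hball⟩ := Metric.nhds_basis_closedBall.mem_iff.1 (mem_interior_iff_mem_nhds.1 ho)
  have hd : 0 < planeDet u v := by
    have h1 : (r : ℂ) ∈ K := hball (by simp [abs_of_pos hr])
    have h2 : (r : ℂ) * Complex.I ∈ K := hball (by simp [abs_of_pos hr])
    refine lt_of_lt_of_le ?_ (hmax' _ h1 _ h2)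
    simp [planeDet]
    positivity
  have hd' := hd.ne'
  set d := planeDet u v with hdd
  have hsymL : polarBody K = -polarBody K := by
    ext x
    constructor
    · intro hx y hy
      rw [inner_neg_left, ← inner_neg_right]
      exact hx _ (hneg y hy)
    · intro hx y hy
      have := hx _ (hneg y hy)
      rwa [inner_neg_neg] at this
  have hinner₁ : ∀ w, ⟪(⟨v.im / d, -v.re / d⟩ : ℂ), w⟫ = planeDet w v / d := by
    intro w
    rw [inner_eq_re_add_im, planeDet]
    ring
  have hinner₂ : ∀ w, ⟪(⟨-u.im / d, u.re / d⟩ : ℂ), w⟫ = planeDet u w / d := by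
    intro w
    rw [inner_eq_re_add_im, planeDet]
    ring
  refine ⟨u, v, ⟨v.im / d, -v.re / d⟩, ⟨-u.im / d, u.re / d⟩, ?_⟩
  refine
    { convex_left := hconv
      convex_right := convex_polarBody K
      measurable_left := hcomp.isClosed.measurableSet
      measurable_right := (isClosed_polarBody K).measurableSet
      finite_left := hcomp.measure_lt_top.ne
      finite_right := volume_polarBody_ne_top ho
      symm_left := hsym
      symm_right := hsymL
      left_eq := (polarBody_polarBody hconv hcomp.isClosed h0).symm
      right_eq := rfl
      u_mem := hu
      v_mem := hv
      u'_mem := fun w hw => ?_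
      v'_mem := fun w hw => ?_
      det_pos := hd
      det_mul := ?_
      expand_left := fun w => ?_
      expand_right := fun w => ?_ }
  · rw [hinner₁, div_le_one hd]
    exact hmax' w hw v hv
  · rw [hinner₂, div_le_one hd]
    exact hmax' u hu w hw
  · rw [← hdd]
    simp only [planeDet]
    field_simp
    rw [hdd, planeDet]
    ring
  · rw [hinner₁, hinner₂]
    apply Complex.ext <;> simp <;> field_simp <;> simp only [hdd, planeDet] <;> ring
  · simp only [inner_eq_re_add_im]
    apply Complex.ext <;> simp <;> field_simp <;> simp only [hdd, planeDet] <;> ring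

theorem parallelogram_mem {c a b : ℂ} {s t : ℝ} (hs : |s| ≤ 1) (ht : |t| ≤ 1) :
    c + (s • a + t • b) ∈
      convexHull ℝ {c + a + b, c + a - b, c - a + b, c - a - b} := by
  rw [abs_le] at hs ht
  set S : Set ℂ := {c + a + b, c + a - b, c - a + b, c - a - b} with hS
  have hsub := subset_convexHull ℝ S
  have hconv := convex_convexHull ℝ S
  have h1 : c + a + t • b ∈ convexHull ℝ S := by
    have := hconv (hsub (show c + a + b ∈ S by simp [hS])) (hsub (show c + a - b ∈ S by simp [hS]))
      (show 0 ≤ (1 + t) / 2 by linarith) (show 0 ≤ (1 - t) / 2 by linarith) (by ring)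
    convert this using 1
    module
  have h2 : c - a + t • b ∈ convexHull ℝ S := by
    have := hconv (hsub (show c - a + b ∈ S by simp [hS])) (hsub (show c - a - b ∈ S by simp [hS]))
      (show 0 ≤ (1 + t) / 2 by linarith) (show 0 ≤ (1 - t) / 2 by linarith) (by ring)
    convert this using 1
    module
  have := hconv h1 h2
    (show 0 ≤ (1 + s) / 2 by linarith) (show 0 ≤ (1 - s) / 2 by linarith) (by ring)
  convert this using 1
  module

/-- A convex set between a centred parallelogram and its dilate by `t` is at Banach–Mazur
distance at most `t` from any parallelogram. -/
theorem distBM_le_of_sandwich {K P : Set ℂ} (hK : Convex ℝ K) (hP : IsParallelogram P)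
    {e f : ℂ} (hef : LinearIndependent ℝ ![e, f]) {t : ℝ} (ht : 0 < t)
    (hsub : ∀ w ∈ K, ∃ x y : ℝ, w = x • e + y • f ∧ |x| ≤ t ∧ |y| ≤ t)
    (h₁ : e + f ∈ K) (h₂ : e - f ∈ K) (h₃ : -e + f ∈ K) (h₄ : -e - f ∈ K) :
    distBM K P ≤ t := by
  obtain ⟨c, a, b, hab, rfl⟩ := hP
  have hcard : Fintype.card (Fin 2) = Module.finrank ℝ ℂ := by simp
  let B := basisOfLinearIndependentOfCardEqFinrank hef hcard
  let C := basisOfLinearIndependentOfCardEqFinrank hab hcard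
  let T : ℂ ≃ₗ[ℝ] ℂ := B.equiv C (Equiv.refl _)
  have hTe : T e = a := by
    have := B.equiv_apply (b' := C) 0 (Equiv.refl _)
    simpa [B, C] using this
  have hTf : T f = b := by
    have := B.equiv_apply (b' := C) 1 (Equiv.refl _)
    simpa [B, C] using this
  let A : ℂ ≃ᵃ[ℝ] ℂ := T.toAffineEquiv.trans (AffineEquiv.constVAdd ℝ ℂ (t • c))
  have hA : ∀ w, A w = t • c + T w := fun w => rfl
  refine csInf_le ⟨0, ?_⟩ ⟨1 / t, 1, A, c - t • c, by positivity, one_pos, by simp, ?_, ?_⟩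
  · rintro r ⟨l1, l2, _, _, h1, h2, rfl, _⟩
    positivity
  · rintro _ ⟨_, ⟨w, hw, rfl⟩, rfl⟩
    obtain ⟨x, y, rfl, hx, hy⟩ := hsub w hw
    have : (1 / t) • A (x • e + y • f) = c + ((x / t) • a + (y / t) • b) := by
      rw [hA, map_add, map_smul, map_smul, hTe, hTf, smul_add, smul_add, smul_smul, smul_smul,
        smul_smul, one_div_mul_cancel ht.ne', one_smul, div_mul_eq_mul_div, div_mul_eq_mul_div,
        one_mul, one_mul]
    dsimp only
    rw [this]
    apply parallelogram_mem <;> rw [abs_div, abs_of_pos ht, div_le_one ht] <;> assumption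
  · have himage : ∀ w ∈ K, c + T w ∈ (c - t • c) +ᵥ (1 : ℝ) • (A '' K) := by
      intro w hw
      refine ⟨A w, by rw [one_smul]; exact ⟨w, hw, rfl⟩, ?_⟩
      simp only [hA, vadd_eq_add]
      abel
    refine convexHull_min ?_ (((hK.affine_image (A : ℂ →ᵃ[ℝ] ℂ)).smul 1).vadd _)
    rintro _ (rfl | rfl | rfl | rfl)
    · convert himage _ h₁ using 1
      rw [map_add, hTe, hTf]; abel
    · convert himage _ h₂ using 1
      rw [map_sub, hTe, hTf]; abel
    · convert himage _ h₃ using 1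
      rw [map_add, map_neg, hTe, hTf]; abel
    · convert himage _ h₄ using 1
      rw [map_sub, map_neg, hTe, hTf]; abel

theorem linearIndependent_of_planeDet {e f : ℂ} (h : planeDet e f ≠ 0) :
    LinearIndependent ℝ ![e, f] := by
  rw [LinearIndependent.pair_iff]
  intro s t hst
  have h1 := congrArg Complex.re hst
  have h2 := congrArg Complex.im hst
  simp at h1 h2
  unfold planeDet at h
  constructor
  · refine (mul_eq_zero.1 (?_ : s * (e.re * f.im - e.im * f.re) = 0)).resolve_right h
    linear_combination f.im * h1 - f.re * h2
  · refine (mul_eq_zero.1 (?_ : t * (e.re * f.im - e.im * f.re) = 0)).resolve_right h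
    linear_combination e.re * h2 - e.im * h1

namespace PolarFrame

variable {K L P : Set ℂ} {u v u' v' : ℂ}

theorem neg_inner_le_one (F : PolarFrame K L u v u' v') {w z : ℂ} (hw : w ∈ L) (hz : z ∈ K) :
    -1 ≤ ⟪w, z⟫ := by
  have := F.inner_le_one hw (F.neg_mem hz)
  rw [inner_neg_right] at this
  linarith

theorem distBM_le_of_inner_le (F : PolarFrame K L u v u' v') (hP : IsParallelogram P) {t : ℝ}
    (ht : 0 < t)
    (h : ∀ w ∈ K, ⟪u', w⟫ + ⟪v', w⟫ ≤ t ∧ ⟪v', w⟫ - ⟪u', w⟫ ≤ t) : distBM K P ≤ t := by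
  have hd := F.det_pos
  refine distBM_le_of_sandwich F.convex_left hP (e := (1 / 2 : ℝ) • (u - v))
    (f := (1 / 2 : ℝ) • (u + v)) (linearIndependent_of_planeDet ?_) ht ?_ ?_ ?_ ?_ ?_
  · have : planeDet ((1 / 2 : ℝ) • (u - v)) ((1 / 2 : ℝ) • (u + v)) = planeDet u v / 2 := by
      simp [planeDet]; ring
    rw [this]; positivity
  · intro w hw
    refine ⟨⟪u', w⟫ - ⟪v', w⟫, ⟪u', w⟫ + ⟪v', w⟫, ?_, ?_, ?_⟩
    · conv_lhs => rw [F.expand_left w]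
      module
    all_goals
      have h1 := h w hw
      have h2 := h (-w) (F.neg_mem hw)
      simp only [inner_neg_right] at h2
      rw [abs_le]
      constructor <;> linarith
  · convert F.u_mem using 1; module
  · convert F.neg_mem F.v_mem using 1; module
  · convert F.v_mem using 1; module
  · convert F.neg_mem F.u_mem using 1; module

theorem distBM_le_two (F : PolarFrame K L u v u' v') (hP : IsParallelogram P) :
    distBM K P ≤ 2 := by
  refine F.distBM_le_of_inner_le hP two_pos fun w hw => ?_
  have := F.inner_le_one F.u'_mem hw
  have := F.inner_le_one F.v'_mem hw
  have := F.neg_inner_le_one F.u'_mem hw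
  constructor <;> linarith

theorem distBM_le_of_left (F : PolarFrame K L u v u' v') (hP : IsParallelogram P) {t : ℝ}
    (h₁ : sectorRatio K u v ≤ t) (h₂ : sectorRatio K v (-u) ≤ t) : distBM K P ≤ t := by
  refine F.distBM_le_of_inner_le hP (by linarith [F.one_le_sectorRatio]) fun w hw => ?_
  have := F.inner_add_inner_le hw
  have h := F.rotate.inner_add_inner_le hw
  rw [inner_neg_left] at h
  constructor <;> linarith

theorem distBM_le_of_right (F : PolarFrame K L u v u' v') (hP : IsParallelogram P) {t : ℝ}
    (h₁ : sectorRatio L u' v' ≤ t) (h₂ : sectorRatio L v' (-u') ≤ t) : distBM K P ≤ t := by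
  have ht : 0 < t := by linarith [F.swap.one_le_sectorRatio]
  have hd := F.det_pos
  have hp := F.swap.diagonal_mem h₁
  have hq := F.swap.rotate.diagonal_mem h₂
  refine distBM_le_of_sandwich F.convex_left hP (e := t⁻¹ • u)
    (f := t⁻¹ • v) (linearIndependent_of_planeDet ?_) ht ?_ hp ?_ ?_ ?_
  · have : planeDet (t⁻¹ • u) (t⁻¹ • v) = t⁻¹ * t⁻¹ * planeDet u v := by
      simp [planeDet]; ring
    rw [this]; positivity
  · intro w hw
    refine ⟨t * ⟪u', w⟫, t * ⟪v', w⟫, ?_, ?_, ?_⟩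
    · conv_lhs => rw [F.expand_left w]
      rw [smul_smul, smul_smul, mul_right_comm, mul_inv_cancel₀ ht.ne', one_mul, mul_right_comm,
        mul_inv_cancel₀ ht.ne', one_mul]
    all_goals
      rw [abs_mul, abs_of_pos ht]
      refine mul_le_of_le_one_right ht.le (abs_le.2 ⟨?_, ?_⟩)
    · exact F.neg_inner_le_one F.u'_mem hw
    · exact F.inner_le_one F.u'_mem hw
    · exact F.neg_inner_le_one F.v'_mem hw
    · exact F.inner_le_one F.v'_mem hw
  · convert F.neg_mem hq using 1; module
  · convert hq using 1; module
  · convert F.neg_mem hp using 1; module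

theorem sectorRatio_near (F : PolarFrame K L u v u' v') {ε : ℝ} (hε : 0 < ε)
    (hε' : ε < 1 / 200) (h : sectorRatio K u v * sectorRatio L u' v' ≤ 2 + 8 * ε) :
    sectorRatio L u' v' ≤ 1 + 34 * ε ∨ 2 - 34 * ε ≤ sectorRatio L u' v' := by
  by_contra! hcon
  obtain ⟨h1, h2⟩ := hcon
  have hstab := F.two_sub_mul_sub_one_le (by linarith)
  have hm := F.two_le_mul
  generalize sectorRatio K u v * sectorRatio L u' v' = M at *
  generalize sectorRatio L u' v' = B at *
  have h3 : (M - 2) ^ 2 ≤ 1 / 25 * (M - 2) := by nlinarith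
  have h4 : B * (M - 2) ^ 2 ≤ 2 * (1 / 25 * (M - 2)) :=
    mul_le_mul (by linarith) h3 (sq_nonneg _) (by norm_num)
  have h5 : 0 < (2 - 34 * ε - B) * (B - (1 + 34 * ε)) :=
    mul_pos (by linarith) (by linarith)
  nlinarith

end PolarFrame

theorem le_of_mul_le_of_near_two {A B ε : ℝ} (hε : 0 < ε) (hε' : ε < 1 / 200)
    (h : A * B ≤ 2 + 8 * ε) (hB : 2 - 34 * ε ≤ B) : A ≤ 1 + 200 * ε := by
  by_contra! hA
  have : (1 + 200 * ε) * (2 - 34 * ε) ≤ A * B :=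
    mul_le_mul hA.le hB (by linarith) (by linarith)
  nlinarith

/-- Stability of the Mahler–Reisner inequality: if `K` is `o`-symmetric and
`|K|·|K*| ≤ (1+ε)·8`, then the Banach–Mazur distance of `K` from any
parallelogram `P` is at most `1 + 200ε`. -/
theorem mahler_reisner_stability (K P : Set ℂ) (hK : IsConvexBody K) (hsym : K = -K)
    (ho : (0 : ℂ) ∈ interior K) (hP : IsParallelogram P) (ε : ℝ) (hε : 0 < ε)
    (hvp : area K * area (polarBody K) ≤ (1 + ε) * 8) :
    distBM K P ≤ 1 + 200 * ε := by
  obtain ⟨u, v, u', v', F⟩ := exists_polarFrame hK hsym ho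
  rcases le_or_gt (1 / 200) ε with hε' | hε'
  · linarith [F.distBM_le_two hP]
  have hd := F.det_pos
  have harea : (sectorRatio K u v + sectorRatio K v (-u)) *
      (sectorRatio (polarBody K) u' v' + sectorRatio (polarBody K) v' (-u')) ≤ (1 + ε) * 8 := by
    refine le_trans ?_ hvp
    have h := mul_le_mul F.sectorRatio_add_le F.swap.sectorRatio_add_le
      (mul_nonneg F.swap.det_pos.le (add_nonneg (by linarith [F.swap.one_le_sectorRatio])
        (by linarith [F.swap.rotate.one_le_sectorRatio]))) (area_nonneg K)
    refine le_of_eq_of_le ?_ h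
    linear_combination (-1 : ℝ) * (sectorRatio K u v + sectorRatio K v (-u)) *
      (sectorRatio (polarBody K) u' v' + sectorRatio (polarBody K) v' (-u')) * F.det_mul
  have hA₁ := F.one_le_sectorRatio
  have hA₂ := F.rotate.one_le_sectorRatio
  have hB₁ := F.swap.one_le_sectorRatio
  have hB₂ := F.swap.rotate.one_le_sectorRatio
  have hM₁ := F.two_le_mul
  have hM₂ := F.rotate.two_le_mul
  have hnear₁ := F.sectorRatio_near hε hε'
  have hnear₂ := F.rotate.sectorRatio_near hε hε'
  have hleft := F.distBM_le_of_left hP (t := 1 + 200 * ε)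
  have hright := F.distBM_le_of_right hP (t := 1 + 200 * ε)
  generalize sectorRatio K u v = A₁ at *
  generalize sectorRatio K v (-u) = A₂ at *
  generalize sectorRatio (polarBody K) u' v' = B₁ at *
  generalize sectorRatio (polarBody K) v' (-u') = B₂ at *
  have hcross : 4 ≤ A₁ * B₂ + A₂ * B₁ := by
    have h1 : 2 * 2 ≤ (A₁ * B₁) * (A₂ * B₂) := mul_le_mul hM₁ hM₂ (by norm_num) (by linarith)
    have h2 : 0 < A₁ * B₂ := mul_pos (by linarith) (by linarith)
    have h3 : 0 < A₂ * B₁ := mul_pos (by linarith) (by linarith)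
    nlinarith [sq_nonneg (A₁ * B₂ - A₂ * B₁)]
  have hsum : A₁ * B₁ + A₂ * B₂ + (A₁ * B₂ + A₂ * B₁) ≤ 8 + 8 * ε := by linarith
  have hU₁ : A₁ * B₁ ≤ 2 + 8 * ε := by linarith
  have hU₂ : A₂ * B₂ ≤ 2 + 8 * ε := by linarith
  have mixed : ∀ {a₁ b₁ a₂ b₂ : ℝ}, 1 ≤ a₂ → 1 ≤ b₁ → 2 ≤ a₁ * b₁ → b₁ ≤ 1 + 34 * ε →
      2 - 34 * ε ≤ b₂ → 4 + 8 * ε < a₁ * b₂ + a₂ * b₁ := by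
    intro a₁ b₁ a₂ b₂ ha₂ hb₁ hM hb hb'
    have ha : 17 / 10 ≤ a₁ := by
      by_contra! hlt
      nlinarith
    have h1 : 17 / 10 * (183 / 100) ≤ a₁ * b₂ :=
      mul_le_mul ha (by linarith) (by norm_num) (by linarith)
    have h2 : 1 * 1 ≤ a₂ * b₁ := mul_le_mul ha₂ hb₁ zero_le_one (by linarith)
    linarith
  rcases hnear₁ hU₁ with h₁ | h₁ <;> rcases hnear₂ hU₂ with h₂ | h₂
  · exact hright (by linarith) (by linarith)
  · linarith [mixed hA₂ hB₁ hM₁ h₁ h₂]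
  · linarith [mixed hA₁ hB₂ hM₂ h₂ h₁]
  · exact hleft (le_of_mul_le_of_near_two hε hε' hU₁ h₁)
      (le_of_mul_le_of_near_two hε hε' hU₂ h₂)
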